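/- Let (X, ℝ, α) be a periodic one-parameter C*-dynamical system with X_1 ≠ {0} and X_n = {0} for all |n| ≥ 2 (so sp(α) = {−γ₁, 0, γ₁}), and suppose that J, the closed linear span of {x y* : x, y ∈ X_1}, is a two-sided ideal of X_0 having no norm-closed two-sided ideals other than {0} and J. Then the norm closure of X_0 + X_1 (which equals the analytic subalgebra X^α([0,∞))) is a maximal norm-closed subalgebra of X. -/

import Mathlib

open MeasureTheory Set Filter Topology Pointwise

noncomputable section

namespace PeligradMax

variable {X : Type*} [NonUnitalNormedRing X] [StarRing X] [CStarRing X]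
  [NormedSpace ℂ X] [IsScalarTower ℂ X X] [SMulCommClass ℂ X X] [StarModule ℂ X]
  [CompleteSpace X] [PartialOrder X] [StarOrderedRing X]

/-- A one-parameter C*-dynamical system: a group of *-automorphisms of `X`
with norm-continuous orbit maps. -/
structure IsCStarDynSys (α : ℝ → X → X) : Prop where
  map_zero_time : ∀ x, α 0 x = x
  map_add_time : ∀ s t x, α (s + t) x = α s (α t x)
  map_add : ∀ t x y, α t (x + y) = α t x + α t y
  map_smulc : ∀ (t : ℝ) (c : ℂ) (x : X), α t (c • x) = c • α t x
  map_mul : ∀ t x y, α t (x * y) = α t x * α t y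
  map_star : ∀ t x, α t (star x) = star (α t x)
  continuous_orbit : ∀ x, Continuous fun t => α t x

/-- Closed linear span. -/
def ClosedSpan (S : Set X) : Set X := closure ((Submodule.span ℂ S : Submodule ℂ X) : Set X)

def MulSet2 (S T : Set X) : Set X := {z | ∃ s ∈ S, ∃ t ∈ T, z = s * t}

def MulSet3 (S T R : Set X) : Set X := {z | ∃ s ∈ S, ∃ t ∈ T, ∃ r ∈ R, z = s * t * r}

/-- Fourier transform of an integrable function. -/
def fourierT (f : ℝ → ℂ) (γ : ℝ) : ℂ := ∫ t : ℝ, f t * Complex.exp (-(Complex.I * γ * t))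

/-- `α_f(x) = ∫ f(t) α_t(x) dt`. -/
def smear (α : ℝ → X → X) (f : ℝ → ℂ) (x : X) : X := ∫ t : ℝ, f t • α t x

/-- Arveson spectrum of an element. -/
def elemSpec (α : ℝ → X → X) (x : X) : Set ℝ :=
  {γ | ∀ f : ℝ → ℂ, Integrable f → smear α f x = 0 → fourierT f γ = 0}

/-- Spectral subspace associated with a closed set `F ⊆ ℝ`. -/
def specC (α : ℝ → X → X) (F : Set ℝ) : Set X := {x | elemSpec α x ⊆ F}

/-- Spectral subspace of the subset `S` associated with an open set `U ⊆ ℝ`. -/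
def specO (α : ℝ → X → X) (S : Set X) (U : Set ℝ) : Set X :=
  ClosedSpan {y | ∃ x ∈ S, ∃ f : ℝ → ℂ, Integrable f ∧
    IsCompact (tsupport (fourierT f)) ∧ tsupport (fourierT f) ⊆ U ∧ y = smear α f x}

/-- The fixed point algebra `X^α`. -/
def fixedPts (α : ℝ → X → X) : Set X := {x | ∀ t, α t x = x}

/-- The Arveson spectrum of the action restricted to `S`. -/
def actSpec (α : ℝ → X → X) (S : Set X) : Set ℝ :=
  {γ : ℝ | ∀ ε > (0 : ℝ), S ∩ specC α (Icc (γ - ε) (γ + ε)) ≠ ({0} : Set X)}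

def Invariant (α : ℝ → X → X) (S : Set X) : Prop := ∀ t : ℝ, ∀ x ∈ S, α t x ∈ S

def IsSubalgebra (B : Set X) : Prop :=
  (0 : X) ∈ B ∧ (∀ x ∈ B, ∀ y ∈ B, x + y ∈ B) ∧
  (∀ c : ℂ, ∀ x ∈ B, c • x ∈ B) ∧ ∀ x ∈ B, ∀ y ∈ B, x * y ∈ B

def IsStarSubalgebra (B : Set X) : Prop := IsSubalgebra B ∧ ∀ x ∈ B, star x ∈ B

/-- `B` is a hereditary C*-subalgebra of the subset `S`. -/
def IsHereditaryIn (S B : Set X) : Prop :=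
  B ⊆ S ∧ IsClosed B ∧ IsStarSubalgebra B ∧
  ∀ x ∈ S, ∀ b ∈ B, 0 ≤ x → x ≤ b → x ∈ B

/-- `K` is a norm-closed two-sided ideal of the subset `S`. -/
def IsClosedTwoSidedIdealIn (S K : Set X) : Prop :=
  K ⊆ S ∧ IsClosed K ∧ (0 : X) ∈ K ∧ (∀ x ∈ K, ∀ y ∈ K, x + y ∈ K) ∧
  (∀ c : ℂ, ∀ x ∈ K, c • x ∈ K) ∧ ∀ s ∈ S, ∀ k ∈ K, s * k ∈ K ∧ k * s ∈ K

/-- `S` is `α`-simple: no nontrivial norm-closed `α`-invariant two-sided ideals. -/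
def AlphaSimple (α : ℝ → X → X) (S : Set X) : Prop :=
  ∀ K : Set X, IsClosedTwoSidedIdealIn S K → Invariant α K → K = ({0} : Set X) ∨ K = S

/-- The strong Arveson spectrum of the action restricted to `B`. -/
def strongSpec (α : ℝ → X → X) (B : Set X) : Set ℝ :=
  {γ : ℝ | ∀ ε > (0 : ℝ),
    ClosedSpan (MulSet3 (star '' (B ∩ specC α (Icc (γ - ε) (γ + ε)))) B
      (B ∩ specC α (Icc (γ - ε) (γ + ε)))) = B}

/-- The strong Connes spectrum of the action restricted to `S`. -/
def ConnesSpec (α : ℝ → X → X) (S : Set X) : Set ℝ :=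
  ⋂ B ∈ {B : Set X | IsHereditaryIn S B ∧ B ≠ ({0} : Set X) ∧ Invariant α B},
    strongSpec α B

def IsMaximalClosedSubalgebra (B : Set X) : Prop :=
  IsClosed B ∧ IsSubalgebra B ∧ B ≠ (univ : Set X) ∧
  ∀ W : Set X, IsClosed W → IsSubalgebra W → B ⊆ W → W = B ∨ W = univ

/-- The spectral Condition 4.3. -/
def Condition43 (α : ℝ → X → X) : Prop :=
  (∃ γ₀ : ℝ, 0 < γ₀ ∧ actSpec α (univ : Set X) = ({-γ₀, 0, γ₀} : Set ℝ) ∧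
    IsClosedTwoSidedIdealIn (fixedPts α)
      (ClosedSpan (MulSet2 (specC α ({γ₀} : Set ℝ)) (star '' specC α ({γ₀} : Set ℝ)))) ∧
    ∀ K : Set X,
      IsClosedTwoSidedIdealIn
        (ClosedSpan (MulSet2 (specC α ({γ₀} : Set ℝ)) (star '' specC α ({γ₀} : Set ℝ)))) K →
      K = ({0} : Set X) ∨
        K = ClosedSpan (MulSet2 (specC α ({γ₀} : Set ℝ)) (star '' specC α ({γ₀} : Set ℝ)))) ∨
  (∃ Y : Set X, IsClosedTwoSidedIdealIn (univ : Set X) Y ∧ Invariant α Y ∧ AlphaSimple α Y ∧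
    specO α Y (Ioi (0 : ℝ)) = specO α (univ : Set X) (Ioi (0 : ℝ)) ∧
    actSpec α Y = ConnesSpec α Y ∧
    closure (Y + specC α (Ici (0 : ℝ))) = (univ : Set X))

/-- The spectral subspace `X_n` of a periodic system with period `2π/γ₁`. -/
def specZ (α : ℝ → X → X) (γ₁ : ℝ) (n : ℤ) : Set X :=
  {x | ∀ t : ℝ, α t x = Complex.exp (Complex.I * (((n : ℝ) * γ₁ * t : ℝ) : ℂ)) • x}

/-- Condition (S) for a periodic system. -/
def ConditionS (α : ℝ → X → X) (γ₁ : ℝ) : Prop :=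
  ∃ J : Set X, IsClosedTwoSidedIdealIn (specZ α γ₁ 0) J ∧
    (∀ K : Set X, IsClosedTwoSidedIdealIn J K → K = ({0} : Set X) ∨ K = J) ∧
    ∀ n : ℤ, 0 < n → specZ α γ₁ n ≠ ({0} : Set X) →
      ClosedSpan {z : X | ∃ x ∈ specZ α γ₁ n, ∃ y ∈ specZ α γ₁ n, z = x * star y} = J

set_option linter.unusedSectionVars false

section CStarAlgebra

variable {A : Type*} [NonUnitalCStarAlgebra A]

/-- The function `x ↦ x / (x² + s²)`; multiplied by `x` it approximates the constant `1`
away from `0`. -/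
def approxInv (s x : ℝ) : ℝ := x / (x ^ 2 + s ^ 2)

lemma continuous_approxInv {s : ℝ} (hs : 0 < s) : Continuous (approxInv s) := by
  unfold approxInv
  exact continuous_id.div (by fun_prop) fun x => by positivity

lemma approxInv_zero (s : ℝ) : approxInv s 0 = 0 := by simp [approxInv]

lemma abs_mul_approxInv_le {s : ℝ} (hs : 0 < s) (x : ℝ) :
    |x * (1 - x * approxInv s x) ^ 2| ≤ s := by
  have hd : 0 < x ^ 2 + s ^ 2 := by positivity
  have h : 1 - x * approxInv s x = s ^ 2 / (x ^ 2 + s ^ 2) := by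
    unfold approxInv; field_simp; ring
  rw [h, abs_mul, abs_of_nonneg (sq_nonneg (s ^ 2 / (x ^ 2 + s ^ 2))), div_pow, ← mul_div_assoc,
    div_le_iff₀ (by positivity)]
  have hx : |x| * s ≤ x ^ 2 + s ^ 2 := by nlinarith [sq_abs x, sq_nonneg (|x| - s)]
  have hs' : s ^ 2 ≤ x ^ 2 + s ^ 2 := by nlinarith [sq_nonneg x]
  have := mul_le_mul hx hs' (by positivity) hd.le
  nlinarith

lemma norm_sub_mul_cfc_sq_le (z : A) {s : ℝ} (hs : 0 < s) :
    ‖z - z * (star z * z) * cfcₙ (approxInv s) (star z * z)‖ ^ 2 ≤ s := by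
  set a := star z * z with ha
  have hsa : IsSelfAdjoint a := IsSelfAdjoint.star_mul_self z
  have hg : ContinuousOn (approxInv s) (quasispectrum ℝ a) := (continuous_approxInv hs).continuousOn
  have hg0 := approxInv_zero s
  set h : ℝ → ℝ := fun x => x * approxInv s x with hh
  have hhc : ContinuousOn h (quasispectrum ℝ a) := continuousOn_id.mul hg
  have hh0 : h 0 = 0 := by simp [hh]
  have hmul : a * cfcₙ (approxInv s) a = cfcₙ h a := by
    nth_rewrite 1 [← cfcₙ_id' ℝ a]
    rw [← cfcₙ_mul (fun x => x) (approxInv s) a]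
  have hstar : star (cfcₙ h a) = cfcₙ h a := by
    rw [← cfcₙ_star]; simp
  have hah : a * cfcₙ h a = cfcₙ (fun x => x * h x) a := by
    nth_rewrite 1 [← cfcₙ_id' ℝ a]
    rw [← cfcₙ_mul (fun x => x) h a]
  have hha : cfcₙ h a * a = cfcₙ (fun x => h x * x) a := by
    nth_rewrite 2 [← cfcₙ_id' ℝ a]
    rw [← cfcₙ_mul h (fun x => x) a]
  have hhah : cfcₙ h a * (a * cfcₙ h a) = cfcₙ (fun x => h x * (x * h x)) a := by
    rw [hah, ← cfcₙ_mul h (fun x => x * h x) a]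
  have key : star (z - z * cfcₙ h a) * (z - z * cfcₙ h a) =
      cfcₙ (fun x => x * (1 - x * approxInv s x) ^ 2) a := by
    have e1 : star (z - z * cfcₙ h a) * (z - z * cfcₙ h a) =
        (a - cfcₙ h a * a) - (a * cfcₙ h a - cfcₙ h a * (a * cfcₙ h a)) := by
      rw [star_sub, star_mul, hstar, ha]; noncomm_ring
    rw [e1, hhah, hah, hha]
    nth_rewrite 1 [← cfcₙ_id' ℝ a]
    rw [← cfcₙ_sub (fun x => x) (fun x => h x * x) a,
      ← cfcₙ_sub (fun x => x * h x) (fun x => h x * (x * h x)) a,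
      ← cfcₙ_sub (fun x => x - h x * x) (fun x => x * h x - h x * (x * h x)) a]
    congr 1
    funext x
    simp only [hh]
    ring
  rw [mul_assoc, hmul, sq, ← CStarRing.norm_star_mul_self, key]
  exact norm_cfcₙ_le fun x _ => abs_mul_approxInv_le hs x

end CStarAlgebra

lemma closedSpan_subset {S : Set X} {p : Submodule ℂ X} (hp : IsClosed (p : Set X))
    (h : S ⊆ p) : ClosedSpan S ⊆ p :=
  closure_minimal (Submodule.span_le.2 h) hp

lemma subset_closedSpan (S : Set X) : S ⊆ ClosedSpan S :=
  Submodule.subset_span.trans subset_closure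

lemma mul_mem_of_mem_closedSpan {S : Set X} {p : Submodule ℂ X} (hp : IsClosed (p : Set X))
    {a b : X} (h : ∀ x ∈ S, a * x ∈ p) (hb : b ∈ ClosedSpan S) : a * b ∈ p :=
  closedSpan_subset (p := p.comap (LinearMap.mulLeft ℂ a))
    (hp.preimage (continuous_const.mul continuous_id)) h hb

lemma mul_mem_of_mem_closedSpan' {S : Set X} {p : Submodule ℂ X} (hp : IsClosed (p : Set X))
    {a b : X} (h : ∀ x ∈ S, x * a ∈ p) (hb : b ∈ ClosedSpan S) : b * a ∈ p :=
  closedSpan_subset (p := p.comap (LinearMap.mulRight ℂ a))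
    (hp.preimage (continuous_id.mul continuous_const)) h hb

lemma IsSubalgebra.closure {B : Set X} (hB : IsSubalgebra B) : IsSubalgebra (closure B) :=
  ⟨subset_closure hB.1,
    fun _ hx _ hy => map_mem_closure₂ continuous_add hx hy hB.2.1,
    fun c _ hx => map_mem_closure (continuous_const_smul c) hx (hB.2.2.1 c),
    fun _ hx _ hy => map_mem_closure₂ continuous_mul hx hy hB.2.2.2⟩

/-- A subalgebra as a submodule. -/
def IsSubalgebra.toSubmodule {B : Set X} (hB : IsSubalgebra B) : Submodule ℂ X where
  carrier := B
  add_mem' hx hy := hB.2.1 _ hx _ hy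
  zero_mem' := hB.1
  smul_mem' c _ hx := hB.2.2.1 c _ hx

section Dynamics

variable {α : ℝ → X → X} (hα : IsCStarDynSys α) {γ₁ : ℝ}

/-- Each time-`t` map of a C*-dynamical system as a *-homomorphism. -/
def IsCStarDynSys.toHom (t : ℝ) : X →⋆ₙₐ[ℂ] X where
  toFun := α t
  map_smul' c x := hα.map_smulc t c x
  map_zero' := by simpa using hα.map_smulc t 0 0
  map_add' := hα.map_add t
  map_mul' := hα.map_mul t
  map_star' := hα.map_star t

include hα

lemma IsCStarDynSys.continuous_map (t : ℝ) : Continuous (α t) := by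
  let _ : NonUnitalCStarAlgebra X := {}
  exact map_continuous (hα.toHom t)

omit hα in
lemma mem_specZ_zero_iff {x : X} : x ∈ specZ α γ₁ 0 ↔ ∀ t, α t x = x := by
  simp [specZ]

lemma specZ_add {n : ℤ} {x y : X} (hx : x ∈ specZ α γ₁ n) (hy : y ∈ specZ α γ₁ n) :
    x + y ∈ specZ α γ₁ n := fun t => by
  rw [hα.map_add, hx t, hy t, smul_add]

lemma specZ_smul {n : ℤ} (c : ℂ) {x : X} (hx : x ∈ specZ α γ₁ n) :
    c • x ∈ specZ α γ₁ n := fun t => by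
  rw [hα.map_smulc, hx t, smul_comm]

lemma specZ_zero_mem (n : ℤ) : (0 : X) ∈ specZ α γ₁ n := fun t => by
  simpa using hα.map_smulc t 0 0

lemma specZ_mul {m n k : ℤ} {x y : X} (hx : x ∈ specZ α γ₁ m) (hy : y ∈ specZ α γ₁ n)
    (hk : m + n = k := by norm_num) : x * y ∈ specZ α γ₁ k := fun t => by
  rw [← hk, hα.map_mul, hx t, hy t, smul_mul_smul_comm, ← Complex.exp_add]
  congr 2
  push_cast
  ring

lemma specZ_star {n k : ℤ} {x : X} (hx : x ∈ specZ α γ₁ n) (hk : -n = k := by norm_num) :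
    star x ∈ specZ α γ₁ k := fun t => by
  rw [← hk, hα.map_star, hx t, star_smul, Complex.star_def, ← Complex.exp_conj]
  congr 2
  simp

lemma isClosed_specZ (n : ℤ) : IsClosed (specZ α γ₁ n) := by
  simp only [specZ, ofPred_forall]
  exact isClosed_iInter fun t =>
    isClosed_eq (hα.continuous_map t) (continuous_const_smul _)

omit hα in
lemma specZ_zero_inter_one (hγ₁ : 0 < γ₁) {x : X} (hx0 : x ∈ specZ α γ₁ 0)
    (hx1 : x ∈ specZ α γ₁ 1) : x = 0 := by
  have h := hx1 (Real.pi / γ₁)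
  rw [mem_specZ_zero_iff.1 hx0] at h
  have e : (((1 : ℤ) : ℝ) * γ₁ * (Real.pi / γ₁) : ℝ) = Real.pi := by field_simp; simp
  rw [e, mul_comm, Complex.exp_pi_mul_I, neg_one_smul] at h
  have h2x : (2 : ℂ) • x = 0 := by rw [two_smul]; nth_rewrite 2 [h]; exact add_neg_cancel x
  exact (smul_eq_zero.1 h2x).resolve_left two_ne_zero

lemma cfc_mem_specZ_zero {a : X} (ha : a ∈ specZ α γ₁ 0) (hsa : IsSelfAdjoint a) {s : ℝ}
    (hs : 0 < s) :
    letI : NonUnitalCStarAlgebra X := {}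
    cfcₙ (approxInv s) a ∈ specZ α γ₁ 0 := by
  let _ : NonUnitalCStarAlgebra X := {}
  refine mem_specZ_zero_iff.2 fun t => ?_
  have h := NonUnitalStarAlgHomClass.map_cfcₙ (hα.toHom t) (approxInv s) a
    (continuous_approxInv hs).continuousOn (approxInv_zero s) (hα.continuous_map t) hsa
    (hsa.map (hα.toHom t))
  have e : hα.toHom t a = a := mem_specZ_zero_iff.1 ha t
  rw [e] at h
  exact h

end Dynamics

section Fourier

variable {α : ℝ → X → X} (hα : IsCStarDynSys α) {T : ℝ} (hT : ∀ x : X, α T x = x)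

include hα hT in
lemma periodic_orbit (x : X) : Function.Periodic (fun t => α t x) T := fun t => by
  change α (t + T) x = α t x
  rw [hα.map_add_time, hT]

/-- The orbit map of a periodic system as a continuous function on the circle. -/
def orbitCircle (x : X) : C(AddCircle T, X) where
  toFun := (periodic_orbit hα hT x).lift
  continuous_toFun := continuous_quot_lift _ (hα.continuous_orbit x)

lemma orbitCircle_coe (x : X) (t : ℝ) : orbitCircle hα hT x (t : AddCircle T) = α t x := rfl

variable [Fact (0 < T)]

lemma apply_fourierCoeff (n : ℤ) (x : X) (s : ℝ) :
    α s (fourierCoeff (orbitCircle hα hT x) n) =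
      fourier n (s : AddCircle T) • fourierCoeff (orbitCircle hα hT x) n := by
  let L : X →L[ℂ] X := ⟨⟨⟨α s, hα.map_add s⟩, hα.map_smulc s⟩, hα.continuous_map s⟩
  have hint : Integrable (fun t : AddCircle T => fourier (-n) t • orbitCircle hα hT x t)
      AddCircle.haarAddCircle :=
    (by fun_prop : Continuous _).integrable_of_hasCompactSupport
      (HasCompactSupport.of_compactSpace _)
  have h1 : α s (fourierCoeff (orbitCircle hα hT x) n) =
      ∫ t : AddCircle T, L (fourier (-n) t • orbitCircle hα hT x t) ∂AddCircle.haarAddCircle :=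
    (L.integral_comp_comm hint).symm
  have h2 : ∀ t : AddCircle T, L (fourier (-n) t • orbitCircle hα hT x t) =
      fourier n (s : AddCircle T) •
        (fourier (-n) ((s : AddCircle T) + t) • orbitCircle hα hT x ((s : AddCircle T) + t)) := by
    intro t
    induction t using QuotientAddGroup.induction_on with
    | H t =>
      have h3 : L (orbitCircle hα hT x (t : AddCircle T)) =
          orbitCircle hα hT x ((s : AddCircle T) + (t : AddCircle T)) := by
        rw [← AddCircle.coe_add, orbitCircle_coe, orbitCircle_coe, hα.map_add_time]
        rfl
      rw [map_smul, smul_smul]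
      refine congr_arg₂ _ ?_ h3
      rw [fourier_apply, fourier_apply, fourier_apply, smul_add, AddCircle.toCircle_add,
        ← Circle.coe_mul, ← mul_assoc, ← AddCircle.toCircle_add]
      simp
  rw [h1]
  simp_rw [h2]
  rw [integral_smul, integral_add_left_eq_self
    (fun t : AddCircle T => fourier (-n) t • orbitCircle hα hT x t)]
  rfl

/-- An element with finitely many nonzero Fourier coefficients is their sum. -/
lemma eq_sum_fourierCoeff (x : X) (F : Finset ℤ)
    (hF : ∀ n ∉ F, fourierCoeff (orbitCircle hα hT x) n = 0) :
    x = ∑ n ∈ F, fourierCoeff (orbitCircle hα hT x) n := by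
  refine (SeparatingDual.eq_iff_forall_dual_eq (R := ℂ)).2 fun φ => ?_
  have hint (n : ℤ) : Integrable (fun t : AddCircle T => fourier (-n) t • orbitCircle hα hT x t)
      AddCircle.haarAddCircle :=
    (by fun_prop : Continuous _).integrable_of_hasCompactSupport
      (HasCompactSupport.of_compactSpace _)
  let f : C(AddCircle T, ℂ) := ⟨fun t => φ (orbitCircle hα hT x t), by fun_prop⟩
  have hcoef (n : ℤ) : fourierCoeff f n = φ (fourierCoeff (orbitCircle hα hT x) n) := by
    rw [fourierCoeff, fourierCoeff, ← φ.integral_comp_comm (hint n)]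
    simp [f]
  have hz : ∀ n ∉ F, fourierCoeff f n = 0 := fun n hn => by rw [hcoef, hF n hn, map_zero]
  have hs := has_pointwise_sum_fourier_series_of_summable
    (summable_of_ne_finset_zero (s := F) hz) ((0 : ℝ) : AddCircle T)
  have h0 : f ((0 : ℝ) : AddCircle T) = φ x := by
    change φ (α 0 x) = φ x
    rw [hα.map_zero_time]
  rw [h0] at hs
  have hs' : HasSum (fun n => fourierCoeff f n • fourier n ((0 : ℝ) : AddCircle T))
      (∑ n ∈ F, fourierCoeff f n • fourier n ((0 : ℝ) : AddCircle T)) :=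
    hasSum_sum_of_ne_finset_zero fun n hn => by rw [hz n hn, zero_smul]
  rw [HasSum.unique hs hs', map_sum]
  refine Finset.sum_congr rfl fun n _ => ?_
  rw [hcoef]
  simp

end Fourier

/-- In a periodic system whose spectral subspaces vanish for `|n| ≥ 2`, every element
is a sum of components in `X_{-1}`, `X_0` and `X_1`. -/
lemma exists_decomposition {α : ℝ → X → X} (hα : IsCStarDynSys α) {γ₁ : ℝ} (hγ₁ : 0 < γ₁)
    (hper : ∀ x : X, α (2 * Real.pi / γ₁) x = x)
    (h2 : ∀ n : ℤ, 2 ≤ |n| → specZ α γ₁ n = ({0} : Set X)) (x : X) :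
    ∃ a ∈ specZ α γ₁ (-1), ∃ b ∈ specZ α γ₁ 0, ∃ c ∈ specZ α γ₁ 1, x = a + b + c := by
  have : Fact (0 < 2 * Real.pi / γ₁) := ⟨by positivity⟩
  have hmem (n : ℤ) : fourierCoeff (orbitCircle hα hper x) n ∈ specZ α γ₁ n := fun t => by
    rw [apply_fourierCoeff hα hper, fourier_coe_apply]
    congr 2
    have : (Real.pi : ℂ) ≠ 0 := by exact_mod_cast Real.pi_ne_zero
    have : (γ₁ : ℂ) ≠ 0 := by exact_mod_cast hγ₁.ne'
    push_cast
    field_simp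
  have hsum := eq_sum_fourierCoeff hα hper x {-1, 0, 1} fun n hn => by
    have h := hmem n
    rw [h2 n] at h
    · exact h
    · simp only [Finset.mem_insert, Finset.mem_singleton, not_or] at hn
      rcases abs_cases n with ⟨h, _⟩ | ⟨h, _⟩ <;> omega
  refine ⟨_, hmem (-1), _, hmem 0, _, hmem 1, hsum.trans ?_⟩
  rw [Finset.sum_insert (by decide), Finset.sum_insert (by decide), Finset.sum_singleton, add_assoc]

/-- **Proposition 4.6 iii).** For a periodic system with `sp(α) = {−γ₁, 0, γ₁}` in which
`J`, the closed span of `X_1 X_1*`, is a simple ideal of `X_0`, the norm closure of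
`X_0 + X_1` is a maximal norm-closed subalgebra of `X`. -/
theorem condition43a_maximality (α : ℝ → X → X) (hα : IsCStarDynSys α)
    (γ₁ : ℝ) (hγ₁ : 0 < γ₁) (hper : ∀ x : X, α (2 * Real.pi / γ₁) x = x)
    (h1 : specZ α γ₁ 1 ≠ ({0} : Set X))
    (h2 : ∀ n : ℤ, 2 ≤ |n| → specZ α γ₁ n = ({0} : Set X))
    (hJideal : IsClosedTwoSidedIdealIn (specZ α γ₁ 0)
      (ClosedSpan {z : X | ∃ x ∈ specZ α γ₁ 1, ∃ y ∈ specZ α γ₁ 1, z = x * star y}))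
    (hJsimple : ∀ K : Set X,
      IsClosedTwoSidedIdealIn
        (ClosedSpan {z : X | ∃ x ∈ specZ α γ₁ 1, ∃ y ∈ specZ α γ₁ 1, z = x * star y}) K →
      K = ({0} : Set X) ∨
        K = ClosedSpan {z : X | ∃ x ∈ specZ α γ₁ 1, ∃ y ∈ specZ α γ₁ 1, z = x * star y}) :
    IsMaximalClosedSubalgebra (closure (specZ α γ₁ 0 + specZ α γ₁ 1)) := by
  have hX2 {x y : X} (hx : x ∈ specZ α γ₁ 1) (hy : y ∈ specZ α γ₁ 1) : x * y = 0 := by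
    have h : x * y ∈ specZ α γ₁ 2 := specZ_mul hα hx hy
    rwa [h2 2 (by norm_num)] at h
  have hstar {x : X} (hx : x ∈ specZ α γ₁ (-1)) : star x ∈ specZ α γ₁ 1 := specZ_star hα hx
  have hbase : IsSubalgebra (specZ α γ₁ 0 + specZ α γ₁ 1) := by
    refine ⟨⟨0, specZ_zero_mem hα 0, 0, specZ_zero_mem hα 1, add_zero 0⟩, ?_, ?_, ?_⟩
    · rintro _ ⟨a, ha, b, hb, rfl⟩ _ ⟨c, hc, d, hd, rfl⟩
      exact ⟨a + c, specZ_add hα ha hc, b + d, specZ_add hα hb hd, add_add_add_comm a c b d⟩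
    · rintro k _ ⟨a, ha, b, hb, rfl⟩
      exact ⟨k • a, specZ_smul hα k ha, k • b, specZ_smul hα k hb, (smul_add k a b).symm⟩
    · rintro _ ⟨a, ha, b, hb, rfl⟩ _ ⟨c, hc, d, hd, rfl⟩
      refine ⟨a * c, specZ_mul hα ha hc, a * d + b * c,
        specZ_add hα (specZ_mul hα ha hd) (specZ_mul hα hb hc), ?_⟩
      simp only [add_mul, mul_add, hX2 hb hd]
      abel
  refine ⟨isClosed_closure, hbase.closure, fun huniv => h1 ?_, fun W hWc hW hBW => ?_⟩
  · refine Subset.antisymm (fun y hy => ?_) (singleton_subset_iff.2 (specZ_zero_mem hα 1))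
    have hmem : star y ∈ closure (specZ α γ₁ 0 + specZ α γ₁ 1) := huniv ▸ mem_univ _
    have hprod : y * star y ∈ specZ α γ₁ 1 := by
      rw [← (isClosed_specZ hα 1).closure_eq]
      refine map_mem_closure (continuous_const.mul continuous_id : Continuous (y * ·)) hmem ?_
      rintro _ ⟨a, ha, b, hb, rfl⟩
      change y * (a + b) ∈ _
      rw [mul_add, hX2 hy hb, add_zero]
      exact specZ_mul hα hy ha
    exact CStarRing.mul_star_self_eq_zero_iff y |>.1
      (specZ_zero_inter_one hγ₁ (specZ_mul hα hy (specZ_star hα hy (k := -1))) hprod)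
  · refine or_iff_not_imp_left.2 fun hne => ?_
    have h0W {x : X} (hx : x ∈ specZ α γ₁ 0) : x ∈ W :=
      hBW (subset_closure ⟨x, hx, 0, specZ_zero_mem hα 1, add_zero x⟩)
    have h1W {x : X} (hx : x ∈ specZ α γ₁ 1) : x ∈ W :=
      hBW (subset_closure ⟨0, specZ_zero_mem hα 0, x, hx, zero_add x⟩)
    obtain ⟨v, hv, hvW, hv0⟩ : ∃ v ∈ specZ α γ₁ (-1), v ∈ W ∧ v ≠ 0 := by
      obtain ⟨w, hwW, hwB⟩ := not_subset.1 fun h => hne (Subset.antisymm h hBW)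
      obtain ⟨a, ha, b, hb, c, hc, rfl⟩ := exists_decomposition hα hγ₁ hper h2 w
      refine ⟨a, ha, ?_, ?_⟩
      · have := hW.toSubmodule.sub_mem (hW.toSubmodule.sub_mem hwW (h1W hc)) (h0W hb)
        rwa [add_sub_cancel_right, add_sub_cancel_right] at this
      · rintro rfl
        exact hwB (subset_closure ⟨b, hb, c, hc, by simp⟩)
    set S : Set X := {z : X | ∃ x ∈ specZ α γ₁ 1, ∃ y ∈ specZ α γ₁ 1, z = x * star y} with hS
    set R : Set X := {z : X | ∃ x ∈ specZ α γ₁ 1, ∃ u ∈ specZ α γ₁ (-1), u ∈ W ∧ z = x * u} with hR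
    let p : Submodule ℂ X := (Submodule.span ℂ R).topologicalClosure
    have hp : IsClosed (p : Set X) := isClosed_closure
    have hRp : R ⊆ p := subset_closedSpan R
    have hKJ : ClosedSpan R ⊆ ClosedSpan S := by
      refine closure_mono (Submodule.span_mono ?_)
      rintro _ ⟨x, hx, u, hu, _, rfl⟩
      exact ⟨x, hx, star u, hstar hu, by rw [star_star]⟩
    have hK : IsClosedTwoSidedIdealIn (ClosedSpan S) (ClosedSpan R) := by
      refine ⟨hKJ, hp, p.zero_mem, fun _ hx _ hy => p.add_mem hx hy,
        fun c _ hx => p.smul_mem c hx, fun s hs k hk => ?_⟩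
      have hs0 := hJideal.1 hs
      refine ⟨mul_mem_of_mem_closedSpan hp ?_ hk, mul_mem_of_mem_closedSpan' hp ?_ hk⟩
      · rintro _ ⟨x, hx, u, hu, huW, rfl⟩
        exact hRp ⟨s * x, specZ_mul hα hs0 hx, u, hu, huW, (mul_assoc _ _ _).symm⟩
      · rintro _ ⟨x, hx, u, hu, huW, rfl⟩
        exact hRp ⟨x, hx, u * s, specZ_mul hα hu hs0,
          hW.2.2.2 _ huW _ (h0W hs0), mul_assoc _ _ _⟩
    have hKeq : ClosedSpan R = ClosedSpan S := by
      refine (hJsimple _ hK).resolve_left fun h => hv0 ?_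
      have hmem : star v * v ∈ ClosedSpan R := hRp ⟨star v, hstar hv, v, hv, hvW, rfl⟩
      rw [h] at hmem
      exact (CStarRing.star_mul_self_eq_zero_iff v).1 hmem
    have hm1W {z : X} (hz : z ∈ specZ α γ₁ (-1)) : z ∈ W := by
      let _ : NonUnitalCStarAlgebra X := {}
      have haJ : star z * z ∈ ClosedSpan R := by
        rw [hKeq]
        exact subset_closedSpan S ⟨star z, hstar hz, star z, hstar hz, by rw [star_star]⟩
      have hza : z * (star z * z) ∈ W := by
        refine mul_mem_of_mem_closedSpan (p := hW.toSubmodule) hWc ?_ haJ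
        rintro _ ⟨x, hx, u, hu, huW, rfl⟩
        rw [← mul_assoc]
        exact hW.2.2.2 _ (h0W (specZ_mul hα hz hx)) _ huW
      have ha0 : star z * z ∈ specZ α γ₁ 0 := specZ_mul hα (hstar hz) hz
      rw [← hWc.closure_eq, Metric.mem_closure_iff]
      intro ε hε
      have hs : 0 < ε ^ 2 / 2 := by positivity
      refine ⟨_, hW.2.2.2 _ hza _
        (h0W (cfc_mem_specZ_zero hα ha0 (IsSelfAdjoint.star_mul_self z) hs)), ?_⟩
      rw [dist_eq_norm]
      refine lt_of_pow_lt_pow_left₀ 2 hε.le ((norm_sub_mul_cfc_sq_le z hs).trans_lt ?_)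
      linarith [sq_nonneg ε, pow_pos hε 2]
    refine eq_univ_of_forall fun x => ?_
    obtain ⟨a, ha, b, hb, c, hc, rfl⟩ := exists_decomposition hα hγ₁ hper h2 x
    exact hW.2.1 _ (hW.2.1 _ (hm1W ha) _ (h0W hb)) _ (h1W hc)

end PeligradMax
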